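/- For every sorou h with relative order d, there exists a root of unity z such that the rotation z·h has order d; that is, the least common multiple of the orders of the elements of z·h equals d. -/

import Mathlib

open Complex

noncomputable def nu (n : ℕ) : ℂ := Complex.exp (2 * Real.pi * Complex.I / n)

def IsRootOfUnity (z : ℂ) : Prop := ∃ n : ℕ, 0 < n ∧ z ^ n = 1

def IsSorou (h : Multiset ℂ) : Prop := h ≠ 0 ∧ ∀ z ∈ h, IsRootOfUnity z

noncomputable def rootOrder (z : ℂ) : ℕ := sInf {d : ℕ | 0 < d ∧ z ^ d = 1}

noncomputable def sorouOrder (h : Multiset ℂ) : ℕ := (h.map rootOrder).lcm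

noncomputable def relOrder (h : Multiset ℂ) : ℕ :=
  (h.bind fun a => h.map fun b => rootOrder (a / b)).lcm

def IsMinVanishing (h : Multiset ℂ) : Prop :=
  h.sum = 0 ∧ ∀ g : Multiset ℂ, g ≤ h → g ≠ 0 → g ≠ h → g.sum ≠ 0

theorem rootOrder_eq_orderOf {z : ℂ} (hz : IsRootOfUnity z) : rootOrder z = orderOf z := by
  obtain ⟨n, hn, hzn⟩ := hz
  have hpos : 0 < orderOf z := orderOf_pos_iff.2 (isOfFinOrder_iff_pow_eq_one.2 ⟨n, hn, hzn⟩)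
  refine le_antisymm (Nat.sInf_le ⟨hpos, pow_orderOf_eq_one z⟩) ?_
  exact le_csInf ⟨n, hn, hzn⟩ fun d hd => orderOf_le_of_pow_eq_one hd.1 hd.2

theorem IsRootOfUnity.div {a b : ℂ} (ha : IsRootOfUnity a) (hb : IsRootOfUnity b) :
    IsRootOfUnity (a / b) := by
  obtain ⟨m, hm, ham⟩ := ha
  obtain ⟨n, hn, hbn⟩ := hb
  refine ⟨m * n, Nat.mul_pos hm hn, ?_⟩
  rw [div_pow, pow_mul, ham, mul_comm m n, pow_mul, hbn]
  simp

theorem IsRootOfUnity.ne_zero {a : ℂ} (ha : IsRootOfUnity a) : a ≠ 0 := by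
  rintro rfl
  obtain ⟨n, hn, h⟩ := ha
  simp [hn.ne'] at h

theorem stmt_1 (h : Multiset ℂ) (hs : IsSorou h) :
    ∃ z : ℂ, IsRootOfUnity z ∧ sorouOrder (h.map (fun w => z * w)) = relOrder h := by
  obtain ⟨hne, hroot⟩ := hs
  obtain ⟨c, hc⟩ := Multiset.exists_mem_of_ne_zero hne
  have hone : IsRootOfUnity 1 := ⟨1, one_pos, one_pow 1⟩
  refine ⟨1 / c, hone.div (hroot c hc), ?_⟩
  have hmul (w : ℂ) : 1 / c * w = w / c := by ring
  simp only [hmul]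
  refine Nat.dvd_antisymm (Multiset.lcm_dvd.2 fun k hk => ?_) (Multiset.lcm_dvd.2 fun k hk => ?_)
  · simp only [Multiset.mem_map, exists_exists_and_eq_and] at hk
    obtain ⟨a, ha, rfl⟩ := hk
    exact Multiset.dvd_lcm (Multiset.mem_bind.2 ⟨a, ha, Multiset.mem_map_of_mem _ hc⟩)
  · simp only [Multiset.mem_bind, Multiset.mem_map] at hk
    obtain ⟨a, ha, b, hb, rfl⟩ := hk
    have pow_eq_one {w : ℂ} (hw : w ∈ h) :
        (w / c) ^ sorouOrder (h.map fun w => w / c) = 1 := by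
      rw [← orderOf_dvd_iff_pow_eq_one, ← rootOrder_eq_orderOf ((hroot w hw).div (hroot c hc))]
      exact Multiset.dvd_lcm (Multiset.mem_map_of_mem _ (Multiset.mem_map_of_mem _ hw))
    rw [rootOrder_eq_orderOf ((hroot a ha).div (hroot b hb)), orderOf_dvd_iff_pow_eq_one,
      ← div_div_div_cancel_right₀ (hroot c hc).ne_zero, div_pow, pow_eq_one ha, pow_eq_one hb,
      div_one]
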